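/- There is a constant c depending only on n, R, d (not on C, C̃) such that for all z ∈ ℤ^n, all β ∈ ℝ^R and all integers q with 1 ≤ q ≤ P: |Σ_{y ∈ ℤ^n with z+qy ∈ P𝓑} e(β·f(z+qy)) − q^{−n} P^n I(𝓑, P^d β)| ≤ c (C P^d |β| + 1) q^{1−n} P^{n−1}. -/

import Mathlib

open MeasureTheory Filter MvPolynomial

noncomputable section

/-- `e t = exp (2 π i t)` -/
def eC (t : ℝ) : ℂ := Complex.exp (2 * (Real.pi : ℂ) * Complex.I * (t : ℂ))

abbrev Qbar : Type := AlgebraicClosure ℚ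

/-- Dimension of the affine singular locus of `g` (the common zero set of the partial
derivatives of `g`), as the Krull dimension of its coordinate ring. -/
def singDim (n : ℕ) (g : MvPolynomial (Fin n) Qbar) : WithBot ℕ∞ :=
  ringKrullDim (MvPolynomial (Fin n) Qbar ⧸
    Ideal.span (Set.range fun j : Fin n => MvPolynomial.pderiv j g))

/-- `Δ = max_{b ∈ ℤ^R \ {0}} dim Sing(b₁ g₁ + ⋯ + b_R g_R)`. -/
def birchDelta (n R : ℕ) (g : Fin R → MvPolynomial (Fin n) ℤ) : WithBot ℕ∞ :=
  ⨆ (b : Fin R → ℤ) (_ : b ≠ 0),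
    singDim n (MvPolynomial.map (Int.castRingHom Qbar) (∑ i, b i • g i))

/-- `K = (n - Δ)/2^(d-1)` where `Δ = max_{b ≠ 0} dim Sing(f̃_b)`. -/
def KofDelta (n R d : ℕ) (g : Fin R → MvPolynomial (Fin n) ℤ) (K : ℝ) : Prop :=
  ∃ Δ : ℕ, ((Δ : ℕ∞) : WithBot ℕ∞) = birchDelta n R g ∧
    K = ((n : ℝ) - (Δ : ℝ)) / 2 ^ (d - 1)

/-- The quantity `R(R+1)(d-1)` as a real number. -/
def BB (R d : ℕ) : ℝ := (R : ℝ) * ((R : ℝ) + 1) * ((d : ℝ) - 1)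

/-- The `R × R` minor of the Jacobian matrix of `f` with columns given by the elements
of `I`. -/
def jacMinor {n R : ℕ} (f : Fin R → MvPolynomial (Fin n) ℤ)
    (I : Finset (Fin n)) (hI : I.card = R) : MvPolynomial (Fin n) ℤ :=
  Matrix.det (Matrix.of fun i k : Fin R => MvPolynomial.pderiv (I.orderEmbOfFin hI k) (f i))

/-- `Cv` is the maximum of the absolute values of the coefficients of the `f i`. -/
def coeffMax {n R : ℕ} (f : Fin R → MvPolynomial (Fin n) ℤ) (Cv : ℝ) : Prop :=
  IsGreatest {x : ℝ | ∃ (i : Fin R) (m : (Fin n) →₀ ℕ), x = |((MvPolynomial.coeff m (f i) : ℤ) : ℝ)|} Cv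

/-- The integer points of the dilated box `P𝓑`. -/
def boxPts {n : ℕ} (aB bB : Fin n → ℝ) (P : ℝ) : Finset (Fin n → ℤ) :=
  Finset.Icc (fun j => ⌈P * aB j⌉) (fun j => ⌊P * bB j⌋)

/-- The exponential sum `S(α) = ∑_{x ∈ P𝓑 ∩ ℤ^n} e(α · f(x))`. -/
def Sexp {n R : ℕ} (f : Fin R → MvPolynomial (Fin n) ℤ) (aB bB : Fin n → ℝ) (P : ℝ)
    (α : Fin R → ℝ) : ℂ :=
  ∑ x ∈ boxPts aB bB P, eC (∑ i, α i * (MvPolynomial.eval x (f i) : ℝ))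

/-- The complete exponential sum `S_{a,q} = ∑_{x mod q} e(a · f(x)/q)`. -/
def Sgauss {n R : ℕ} (f : Fin R → MvPolynomial (Fin n) ℤ) (q : ℕ) (a : Fin R → ℤ) : ℂ :=
  ∑ x : Fin n → Fin q,
    eC ((∑ i, (a i : ℝ) * (MvPolynomial.eval (fun j => ((x j : ℕ) : ℤ)) (f i) : ℝ)) / q)

/-- `S_{a,q}(ν) = S_{a,q} e(-a·ν/q)`. -/
def SgaussNu {n R : ℕ} (f : Fin R → MvPolynomial (Fin n) ℤ) (q : ℕ) (a : Fin R → ℤ)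
    (ν : Fin R → ℤ) : ℂ :=
  Sgauss f q a * eC (-(∑ i, (a i : ℝ) * (ν i : ℝ)) / q)

/-- Residues `1 ≤ aᵢ ≤ q` (coded by `Fin q`, shifted by one) with `gcd(a₁, …, a_R, s) = 1`. -/
def resSet (R q s : ℕ) : Finset (Fin R → Fin q) :=
  Finset.univ.filter fun a => Nat.gcd (Finset.univ.gcd fun i => (a i : ℕ) + 1) s = 1

/-- The singular series `𝔖(ν)`. -/
def singularSeries {n R : ℕ} (f : Fin R → MvPolynomial (Fin n) ℤ) (ν : Fin R → ℤ) : ℂ :=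
  ∑' q : ℕ, ((q : ℂ) ^ n)⁻¹ *
    ∑ a ∈ resSet R q q, SgaussNu f q (fun i => ((a i : ℕ) : ℤ) + 1) ν

/-- The local density `𝔖_p(ν)`. -/
def localDensity {n R : ℕ} (f : Fin R → MvPolynomial (Fin n) ℤ) (ν : Fin R → ℤ) (p : ℕ) : ℂ :=
  ∑' r : ℕ, ((p : ℂ) ^ (r * n))⁻¹ *
    ∑ a ∈ resSet R (p ^ r) p, SgaussNu f (p ^ r) (fun i => ((a i : ℕ) : ℤ) + 1) ν

/-- The box `𝓑 = ∏ⱼ [aⱼ, bⱼ]` as a subset of `ℝ^n`. -/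
def boxSet {n : ℕ} (aB bB : Fin n → ℝ) : Set (Fin n → ℝ) :=
  Set.univ.pi fun j => Set.Icc (aB j) (bB j)

/-- The oscillatory integral `I(𝓒, γ) = ∫_{ζ ∈ 𝓒} e(γ · g(ζ)) dζ`. -/
def Iosc {n R : ℕ} (g : Fin R → MvPolynomial (Fin n) ℤ) (C : Set (Fin n → ℝ))
    (γ : Fin R → ℝ) : ℂ :=
  ∫ ζ in C, eC (∑ i, γ i * MvPolynomial.aeval ζ (g i))

/-- `J(μ, Φ) = ∫_{|γ| ≤ Φ} I(𝓑, γ) e(-γ·μ) dγ`. -/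
def Jint {n R : ℕ} (g : Fin R → MvPolynomial (Fin n) ℤ) (aB bB : Fin n → ℝ)
    (μ : Fin R → ℝ) (Φ : ℝ) : ℂ :=
  ∫ γ in {γ : Fin R → ℝ | ∀ i, |γ i| ≤ Φ}, Iosc g (boxSet aB bB) γ * eC (-(∑ i, γ i * μ i))

/-- The singular integral `J(μ) = lim_{Φ → ∞} J(μ, Φ)`. -/
def Jlim {n R : ℕ} (g : Fin R → MvPolynomial (Fin n) ℤ) (aB bB : Fin n → ℝ)
    (μ : Fin R → ℝ) : ℂ :=
  limUnder Filter.atTop fun Φ : ℝ => Jint g aB bB μ Φ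

/-- `M(P, ν)`: the number of integer points `x ∈ P𝓑` with `f(x) = ν`. -/
def Mcount {n R : ℕ} (f : Fin R → MvPolynomial (Fin n) ℤ) (aB bB : Fin n → ℝ) (P : ℝ)
    (ν : Fin R → ℤ) : ℕ :=
  ((boxPts aB bB P).filter fun x => ∀ i, MvPolynomial.eval x (f i) = ν i).card

/-- A single major arc `𝔐_{a,q}(θ)`. -/
def majorArc {R : ℕ} (d : ℕ) (Ct P θ : ℝ) (q : ℕ) (a : Fin R → ℤ) : Set (Fin R → ℝ) :=
  Set.univ.pi fun i => Set.Icc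
    ((a i : ℝ) / q - Ct ^ (R - 1) * P ^ (-(d : ℝ) + (R : ℝ) * ((d : ℝ) - 1) * θ) / (2 * q))
    ((a i : ℝ) / q + Ct ^ (R - 1) * P ^ (-(d : ℝ) + (R : ℝ) * ((d : ℝ) - 1) * θ) / (2 * q))

/-- The major arcs `𝔐(θ)`. -/
def majorArcs (R d : ℕ) (Ct P θ : ℝ) : Set (Fin R → ℝ) :=
  ⋃ (q : ℕ) (_ : 1 ≤ q ∧ (q : ℝ) ≤ Ct ^ R * P ^ ((R : ℝ) * ((d : ℝ) - 1) * θ))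
    (a : Fin R → ℤ)
    (_ : (∀ i, 1 ≤ a i ∧ a i ≤ (q : ℤ)) ∧ Int.gcd (Finset.univ.gcd a) (q : ℤ) = 1),
    majorArc d Ct P θ q a

/-- The minor arcs `𝔪 = [0,1]^R \ 𝔐(θ)`, taken modulo `1`. -/
def minorArcs (R d : ℕ) (Ct P θ : ℝ) : Set (Fin R → ℝ) :=
  {α | (∀ i, 0 ≤ α i ∧ α i ≤ 1) ∧
    ∀ z : Fin R → ℤ, (fun i => α i + (z i : ℝ)) ∉ majorArcs R d Ct P θ}

/-- Nonsingularity of the affine variety `f = 0` over `ℚ̄`: at every common zero the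
Jacobian matrix has (maximal) rank `R`, i.e. some `R × R` minor is nonvanishing. -/
def AffineNonsingular {n : ℕ} (R : ℕ) (f : Fin R → MvPolynomial (Fin n) ℤ) : Prop :=
  ∀ x : Fin n → Qbar, (∀ i, MvPolynomial.aeval x (f i) = 0) →
    ∃ (I : Finset (Fin n)) (hI : I.card = R), MvPolynomial.aeval x (jacMinor f I hI) ≠ 0

/-- Nonsingularity of the projective variety `g = 0` over `ℚ̄` (for forms `g`): at every
nonzero point of the affine cone the Jacobian matrix has rank `R`. -/
def ProjNonsingular {n : ℕ} (R : ℕ) (g : Fin R → MvPolynomial (Fin n) ℤ) : Prop :=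
  ∀ x : Fin n → Qbar, x ≠ 0 → (∀ i, MvPolynomial.aeval x (g i) = 0) →
    ∃ (I : Finset (Fin n)) (hI : I.card = R), MvPolynomial.aeval x (jacMinor g I hI) ≠ 0


lemma eC_norm (t : ℝ) : ‖eC t‖ = 1 := by
  unfold eC
  rw [show 2 * (Real.pi : ℂ) * Complex.I * (t : ℂ) = ((2 * Real.pi * t : ℝ) : ℂ) * Complex.I by
    push_cast; ring]
  exact Complex.norm_exp_ofReal_mul_I _

lemma eC_continuous : Continuous eC := by
  unfold eC; fun_prop

lemma eC_lip (s t : ℝ) : ‖eC s - eC t‖ ≤ 2 * Real.pi * |s - t| := by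
  have h : eC s - eC t = eC t * (Complex.exp (Complex.I * ((2 * Real.pi * (s - t) : ℝ) : ℂ)) - 1) := by
    unfold eC
    rw [mul_sub, ← Complex.exp_add, mul_one]
    congr 2
    push_cast; ring
  rw [h, norm_mul, eC_norm, one_mul]
  refine (Real.norm_exp_I_mul_ofReal_sub_one_le).trans ?_
  rw [Real.norm_eq_abs, abs_mul, abs_of_pos (by positivity : 0 < 2 * Real.pi)]

lemma mon_add {P q a₁ a₂ b₁ b₂ : ℝ} {k l : ℕ} (hP : 1 ≤ P)
    (h1 : |a₁| ≤ P ^ k ∧ |a₂| ≤ P ^ k ∧ P * |a₁ - a₂| ≤ k * q * P ^ k)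
    (h2 : |b₁| ≤ P ^ l ∧ |b₂| ≤ P ^ l ∧ P * |b₁ - b₂| ≤ l * q * P ^ l) :
    |a₁ * b₁| ≤ P ^ (k + l) ∧ |a₂ * b₂| ≤ P ^ (k + l) ∧
      P * |a₁ * b₁ - a₂ * b₂| ≤ (k + l : ℕ) * q * P ^ (k + l) := by
  obtain ⟨h1a, h1b, h1c⟩ := h1
  obtain ⟨h2a, h2b, h2c⟩ := h2
  have hP0 : 0 < P := by linarith
  refine ⟨?_, ?_, ?_⟩
  · rw [abs_mul, pow_add]; gcongr
  · rw [abs_mul, pow_add]; gcongr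
  · have e : a₁ * b₁ - a₂ * b₂ = (a₁ - a₂) * b₁ + a₂ * (b₁ - b₂) := by ring
    calc P * |a₁ * b₁ - a₂ * b₂| ≤ P * (|a₁ - a₂| * |b₁| + |a₂| * |b₁ - b₂|) := by
          rw [e, ← abs_mul, ← abs_mul]
          gcongr
          exact abs_add_le _ _
      _ = (P * |a₁ - a₂|) * |b₁| + |a₂| * (P * |b₁ - b₂|) := by ring
      _ ≤ (k * q * P ^ k) * P ^ l + P ^ k * (l * q * P ^ l) := by
          have := le_trans (by positivity) h1c
          gcongr
      _ = _ := by push_cast; ring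

lemma mon_bound {n : ℕ} {P q : ℝ} (hP : 1 ≤ P) (x y : Fin n → ℝ)
    (hx : ∀ j, |x j| ≤ P) (hy : ∀ j, |y j| ≤ P) (hxy : ∀ j, |x j - y j| ≤ q)
    (m : Fin n →₀ ℕ) :
    |∏ j, x j ^ m j| ≤ P ^ m.degree ∧ |∏ j, y j ^ m j| ≤ P ^ m.degree ∧
      P * |∏ j, x j ^ m j - ∏ j, y j ^ m j| ≤ m.degree * q * P ^ m.degree := by
  rw [Finsupp.degree_eq_sum]
  have hpow : ∀ j, ∀ k : ℕ, |x j ^ k| ≤ P ^ k ∧ |y j ^ k| ≤ P ^ k ∧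
      P * |x j ^ k - y j ^ k| ≤ k * q * P ^ k := by
    intro j k
    induction k with
    | zero => simp
    | succ k ih =>
      rw [pow_succ, pow_succ (y j)]
      refine mon_add hP ih ⟨by simpa using hx j, by simpa using hy j, ?_⟩
      have := hxy j
      have hP0 : 0 < P := by linarith
      calc P * |x j - y j| ≤ P * q := by gcongr
        _ = _ := by push_cast; ring
  have key : ∀ s : Finset (Fin n), |∏ j ∈ s, x j ^ m j| ≤ P ^ (∑ j ∈ s, m j) ∧
      |∏ j ∈ s, y j ^ m j| ≤ P ^ (∑ j ∈ s, m j) ∧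
      P * |∏ j ∈ s, x j ^ m j - ∏ j ∈ s, y j ^ m j| ≤
        (∑ j ∈ s, m j : ℕ) * q * P ^ (∑ j ∈ s, m j) := by
    intro s
    induction s using Finset.induction_on with
    | empty => simp
    | insert a s ha ih =>
      rw [Finset.prod_insert ha, Finset.prod_insert ha, Finset.sum_insert ha]
      exact mon_add hP (hpow a _) ih
  exact key _

lemma poly_bound {n d : ℕ} (hd : 1 ≤ d) (f : MvPolynomial (Fin n) ℤ) (hf : f.totalDegree = d)
    (C : ℝ) (hC : ∀ m, |((f.coeff m : ℤ) : ℝ)| ≤ C) {P q : ℝ} (hP : 1 ≤ P) (hq : 1 ≤ q)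
    (x : Fin n → ℤ) (ζ : Fin n → ℝ)
    (hx : ∀ j, |(x j : ℝ)| ≤ P) (hy : ∀ j, |P * ζ j| ≤ P) (hxy : ∀ j, |(x j : ℝ) - P * ζ j| ≤ q) :
    P * |((MvPolynomial.eval x f : ℤ) : ℝ) -
        P ^ d * MvPolynomial.aeval ζ (MvPolynomial.homogeneousComponent d f)| ≤
      ((Finset.Iic (Finsupp.equivFunOnFinite.symm (fun _ : Fin n => d))).card : ℝ) *
        (C * d * q * P ^ d) := by
  set S := Finset.Iic (Finsupp.equivFunOnFinite.symm (fun _ : Fin n => d)) with hS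
  have hP0 : 0 < P := by linarith
  have hC0 : 0 ≤ C := (abs_nonneg _).trans (hC 0)
  have hdeg : ∀ m ∈ f.support, m.degree ≤ d := by
    intro m hm
    have := MvPolynomial.le_totalDegree hm
    rw [hf] at this
    exact this
  have hsub : f.support ⊆ S := by
    intro m hm
    rw [hS, Finset.mem_Iic]
    intro j
    have h1 := hdeg m hm
    rw [Finsupp.degree_eq_sum] at h1
    simpa using (Finset.single_le_sum (f := fun j => m j) (fun _ _ => Nat.zero_le _)
      (Finset.mem_univ j)).trans h1
  have e1 : ((MvPolynomial.eval x f : ℤ) : ℝ) =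
      ∑ m ∈ S, ((f.coeff m : ℤ) : ℝ) * ∏ j, (x j : ℝ) ^ m j := by
    rw [MvPolynomial.eval_eq']
    push_cast
    refine Finset.sum_subset hsub fun m _ hm => ?_
    rw [MvPolynomial.notMem_support_iff.mp hm]; simp
  have e2 : P ^ d * MvPolynomial.aeval ζ (MvPolynomial.homogeneousComponent d f) =
      ∑ m ∈ S, ((f.coeff m : ℤ) : ℝ) * if m.degree = d then ∏ j, (P * ζ j) ^ m j else 0 := by
    rw [MvPolynomial.aeval_def, MvPolynomial.eval₂_eq']
    have hs2 : (MvPolynomial.homogeneousComponent d f).support ⊆ S := by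
      refine subset_trans ?_ hsub
      intro m hm
      rw [MvPolynomial.mem_support_iff, MvPolynomial.coeff_homogeneousComponent] at hm
      rw [MvPolynomial.mem_support_iff]
      intro h0; apply hm; simp [h0]
    rw [Finset.sum_subset hs2 (fun m _ hm => by
      rw [MvPolynomial.notMem_support_iff.mp hm]; simp), Finset.mul_sum]
    refine Finset.sum_congr rfl fun m _ => ?_
    rw [MvPolynomial.coeff_homogeneousComponent]
    split_ifs with h
    · have : ∏ j, (P * ζ j) ^ m j = P ^ d * ∏ j, ζ j ^ m j := by
        simp_rw [mul_pow]
        rw [Finset.prod_mul_distrib, Finset.prod_pow_eq_pow_sum, ← Finsupp.degree_eq_sum, h]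
      rw [this]; simp; ring
    · simp
  rw [e1, e2, ← Finset.sum_sub_distrib]
  calc _ ≤ P * ∑ m ∈ S, |((f.coeff m : ℤ) : ℝ) * ∏ j, (x j : ℝ) ^ m j -
        ((f.coeff m : ℤ) : ℝ) * if m.degree = d then ∏ j, (P * ζ j) ^ m j else 0| := by
        gcongr
        exact Finset.abs_sum_le_sum_abs _ _
    _ ≤ ∑ m ∈ S, C * d * q * P ^ d := by
        rw [Finset.mul_sum]
        refine Finset.sum_le_sum fun m _ => ?_
        rw [← mul_sub, abs_mul]
        obtain ⟨b1, b2, b3⟩ := mon_bound hP (fun j => (x j : ℝ)) (fun j => P * ζ j) hx hy hxy m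
        have hd1 : (1 : ℝ) ≤ d := by exact_mod_cast hd
        by_cases hm : m ∈ f.support
        · have hmd := hdeg m hm
          rw [show P * (|((f.coeff m : ℤ) : ℝ)| * |∏ j, (x j : ℝ) ^ m j -
              if m.degree = d then ∏ j, (P * ζ j) ^ m j else 0|) = |((f.coeff m : ℤ) : ℝ)| *
              (P * |∏ j, (x j : ℝ) ^ m j -
              if m.degree = d then ∏ j, (P * ζ j) ^ m j else 0|) by ring,
            show C * d * q * P ^ d = C * (d * q * P ^ d) by ring]
          refine mul_le_mul (hC m) ?_ (by positivity) hC0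
          split_ifs with h
          · rw [h] at b3; exact b3
          · rw [sub_zero]
            calc _ ≤ P * P ^ m.degree := by gcongr
              _ = P ^ (m.degree + 1) := by ring
              _ ≤ P ^ d := pow_le_pow_right₀ hP (by omega)
              _ = 1 * 1 * P ^ d := by ring
              _ ≤ _ := by gcongr
        · rw [MvPolynomial.notMem_support_iff.mp hm]
          simp only [Int.cast_zero, abs_zero, zero_mul, mul_zero]
          positivity
    _ = _ := by rw [Finset.sum_const, nsmul_eq_mul]

/-- A sum over integer points as an integral of a step function. -/
lemma step_integral {n : ℕ} (s : Finset (Fin n → ℤ)) (G : (Fin n → ℤ) → ℂ) :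
    Integrable (fun t : Fin n → ℝ => if (fun j => ⌊t j⌋) ∈ s then G (fun j => ⌊t j⌋) else 0) ∧
    ∫ t : Fin n → ℝ, (if (fun j => ⌊t j⌋) ∈ s then G (fun j => ⌊t j⌋) else 0) = ∑ y ∈ s, G y := by
  have e : (fun t : Fin n → ℝ => if (fun j => ⌊t j⌋) ∈ s then G (fun j => ⌊t j⌋) else 0) =
      fun t => ∑ y ∈ s, (Set.univ.pi fun j => Set.Ico (y j : ℝ) (y j + 1)).indicator
        (fun _ => G y) t := by
    funext t
    have h : ∀ y : Fin n → ℤ, (Set.univ.pi fun j => Set.Ico (y j : ℝ) (y j + 1)).indicator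
        (fun _ => G y) t = if (fun j => ⌊t j⌋) = y then G y else 0 := by
      intro y
      classical
      rw [Set.indicator_apply]
      refine if_congr ?_ rfl rfl
      simp only [Set.mem_univ_pi, Set.mem_Ico, funext_iff, Int.floor_eq_iff]
    simp_rw [h]
    rw [Finset.sum_ite_eq]
  have hm : ∀ y : Fin n → ℤ,
      MeasurableSet (Set.univ.pi fun j => Set.Ico (y j : ℝ) (y j + 1)) := fun y =>
    MeasurableSet.univ_pi fun j => measurableSet_Ico
  have hv : ∀ y : Fin n → ℤ,
      volume (Set.univ.pi fun j => Set.Ico (y j : ℝ) (y j + 1)) = 1 := by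
    intro y
    rw [Real.volume_pi_Ico]; simp
  have hi : ∀ y ∈ s, Integrable ((Set.univ.pi fun j => Set.Ico (y j : ℝ) (y j + 1)).indicator
        (fun _ => G y)) := by
    intro y _
    rw [integrable_indicator_iff (hm y)]
    exact integrableOn_const (by rw [hv]; simp)
  rw [e]
  refine ⟨integrable_finsetSum _ hi, ?_⟩
  rw [integral_finsetSum _ hi]
  refine Finset.sum_congr rfl fun y _ => ?_
  rw [integral_indicator_const _ (hm y)]
  simp [Measure.real, hv]

/-- The slab `A_k ≤ t_k ≤ B_k + 1`, `c_j ≤ t_j ≤ c_j + 1`. -/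
def slab {n : ℕ} (A B c : Fin n → ℝ) (j : Fin n) : Set (Fin n → ℝ) :=
  Set.Icc (fun k => if k = j then c k else A k) (fun k => if k = j then c k + 1 else B k + 1)

lemma slab_vol {n : ℕ} (A B c : Fin n → ℝ) (j : Fin n) (M : ℝ)
    (h0 : ∀ k, 0 ≤ B k - A k) (hM : ∀ k, B k - A k + 1 ≤ M) :
    (volume (slab A B c j)).toReal ≤ M ^ (n - 1) := by
  unfold slab
  rw [Real.volume_Icc_pi_toReal (by
    intro k; have := h0 k; dsimp only; split_ifs <;> linarith)]
  rw [← Finset.mul_prod_erase _ _ (Finset.mem_univ j)]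
  have : ∏ k ∈ Finset.univ.erase j, ((if k = j then c k + 1 else B k + 1) -
      (if k = j then c k else A k)) ≤ ∏ k ∈ Finset.univ.erase j, M := by
    refine Finset.prod_le_prod ?_ ?_
    · intro k _; have := h0 k; split_ifs <;> linarith
    · intro k hk; have := hM k
      rw [if_neg (Finset.ne_of_mem_erase hk), if_neg (Finset.ne_of_mem_erase hk)]; linarith
  rw [Finset.prod_const, Finset.card_erase_of_mem (Finset.mem_univ j), Finset.card_univ,
    Fintype.card_fin] at this
  simpa using this

lemma main_compare {n : ℕ} (hn : 1 ≤ n) (A B : Fin n → ℝ) (M K : ℝ) (hK : 0 ≤ K)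
    (h0 : ∀ k, 0 ≤ B k - A k) (hM : ∀ k, B k - A k + 1 ≤ 2 * M) (hM' : ∀ k, B k - A k ≤ M)
    (G : (Fin n → ℤ) → ℂ) (H : (Fin n → ℝ) → ℂ) (hG : ∀ y, ‖G y‖ ≤ 1) (hH : ∀ t, ‖H t‖ ≤ 1)
    (hHc : Continuous H)
    (hGH : ∀ t, (∀ j, A j ≤ t j ∧ t j ≤ B j) → (∀ j, A j ≤ (⌊t j⌋ : ℝ)) →
      ‖G (fun j => ⌊t j⌋) - H t‖ ≤ K) :
    ‖(∑ y ∈ Finset.Icc (fun j => ⌈A j⌉) (fun j => ⌊B j⌋), G y) - ∫ t in Set.Icc A B, H t‖ ≤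
      K * M ^ n + 2 * n * (2 * M) ^ (n - 1) := by
  obtain ⟨hi, he⟩ := step_integral (Finset.Icc (fun j => ⌈A j⌉) (fun j => ⌊B j⌋)) G
  have hDm : MeasurableSet (Set.Icc A B) := measurableSet_Icc
  have hDi : Integrable ((Set.Icc A B).indicator H) :=
    (integrable_indicator_iff hDm).2 (hHc.continuousOn.integrableOn_compact isCompact_Icc)
  have hsm : ∀ c j, MeasurableSet (slab A B c j) := fun c j => measurableSet_Icc
  have hsi : ∀ c j, Integrable ((slab A B c j).indicator (fun _ => (1 : ℝ))) := by
    intro c j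
    rw [integrable_indicator_iff (hsm c j)]
    exact integrableOn_const (isCompact_Icc.measure_lt_top.ne)
  have hKi : Integrable ((Set.Icc A B).indicator (fun _ => K)) := by
    rw [integrable_indicator_iff hDm]
    exact integrableOn_const (isCompact_Icc.measure_lt_top.ne)
  rw [← he, ← integral_indicator hDm, ← integral_sub hi hDi]
  have hsum : Integrable (fun t => ∑ j : Fin n, ((slab A B A j).indicator (fun _ => (1 : ℝ)) t +
      (slab A B B j).indicator (fun _ => (1 : ℝ)) t)) :=
    integrable_finsetSum _ fun j _ => (hsi A j).add (hsi B j)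
  have hnn : ∀ t c j, 0 ≤ (slab A B c j).indicator (fun _ => (1 : ℝ)) t := fun t c j =>
    Set.indicator_nonneg (fun _ _ => zero_le_one) _
  have hone : ∀ t, (∃ j, t ∈ slab A B A j ∨ t ∈ slab A B B j) →
      1 ≤ ∑ j : Fin n, ((slab A B A j).indicator (fun _ => (1 : ℝ)) t +
      (slab A B B j).indicator (fun _ => (1 : ℝ)) t) := by
    rintro t ⟨j, hj⟩
    refine le_trans ?_ (Finset.single_le_sum (f := fun j => ((slab A B A j).indicator
      (fun _ => (1 : ℝ)) t + (slab A B B j).indicator (fun _ => (1 : ℝ)) t))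
      (fun j _ => add_nonneg (hnn t A j) (hnn t B j)) (Finset.mem_univ j))
    have h1 := hnn t A j
    have h2 := hnn t B j
    rcases hj with hj | hj
    · have := Set.indicator_of_mem hj (fun _ => (1 : ℝ)); linarith
    · have := Set.indicator_of_mem hj (fun _ => (1 : ℝ)); linarith
  have hsnn : ∀ t, 0 ≤ ∑ j : Fin n, ((slab A B A j).indicator (fun _ => (1 : ℝ)) t +
      (slab A B B j).indicator (fun _ => (1 : ℝ)) t) := fun t =>
    Finset.sum_nonneg fun j _ => add_nonneg (hnn t A j) (hnn t B j)
  have hpt : ∀ t, ‖(if (fun j => ⌊t j⌋) ∈ Finset.Icc (fun j => ⌈A j⌉) (fun j => ⌊B j⌋) then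
      G (fun j => ⌊t j⌋) else 0) - (Set.Icc A B).indicator H t‖ ≤
      (Set.Icc A B).indicator (fun _ => K) t +
      ∑ j : Fin n, ((slab A B A j).indicator (fun _ => (1 : ℝ)) t +
      (slab A B B j).indicator (fun _ => (1 : ℝ)) t) := by
    intro t
    have hs0 := hsnn t
    by_cases hD : t ∈ Set.Icc A B
    · rw [Set.indicator_of_mem hD, Set.indicator_of_mem hD]
      split_ifs with hf
      · rw [Finset.mem_Icc] at hf
        have := hGH t (fun j => ⟨hD.1 j, hD.2 j⟩) (fun j => Int.ceil_le.mp (hf.1 j))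
        linarith
      · have hex : ∃ j, ⌊t j⌋ < ⌈A j⌉ := by
          by_contra hcon
          push Not at hcon
          exact hf (Finset.mem_Icc.2 ⟨hcon, fun j => Int.floor_mono (hD.2 j)⟩)
        obtain ⟨j, hj⟩ := hex
        have h1 : t j < A j + 1 := by
          have h2 : t j < ⌊t j⌋ + 1 := Int.lt_floor_add_one _
          have h3 : (⌊t j⌋ : ℝ) + 1 ≤ ⌈A j⌉ := by exact_mod_cast hj
          have h4 := Int.ceil_lt_add_one (A j)
          linarith
        have := hone t ⟨j, Or.inl ⟨fun k => by
          have := hD.1 k; dsimp only; split_ifs <;> exact this, fun k => by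
          have := hD.2 k; dsimp only; split_ifs with hk
          · subst hk; exact h1.le
          · linarith⟩⟩
        rw [zero_sub, norm_neg]
        have := hH t
        linarith
    · rw [Set.indicator_of_notMem hD, Set.indicator_of_notMem hD, sub_zero, zero_add]
      split_ifs with hf
      · rw [Finset.mem_Icc] at hf
        have hl : ∀ k, A k ≤ t k := fun k =>
          (Int.ceil_le.mp (hf.1 k)).trans (Int.floor_le _)
        have hu : ∀ k, t k ≤ B k + 1 := fun k => by
          have h2 : t k < ⌊t k⌋ + 1 := Int.lt_floor_add_one _
          have h3 : (⌊t k⌋ : ℝ) ≤ ⌊B k⌋ := by exact_mod_cast hf.2 k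
          have h4 := Int.floor_le (B k)
          linarith
        have hex : ∃ j, B j < t j := by
          by_contra hcon
          push Not at hcon
          exact hD ⟨hl, hcon⟩
        obtain ⟨j, hj⟩ := hex
        have := hone t ⟨j, Or.inr ⟨fun k => by
          dsimp only; split_ifs with hk
          · subst hk; exact hj.le
          · exact hl k, fun k => by
          have := hu k; dsimp only; split_ifs <;> exact this⟩⟩
        exact (hG _).trans this
      · rw [norm_zero]; exact hs0
  refine (norm_integral_le_of_norm_le (hKi.add hsum) (Filter.Eventually.of_forall hpt)).trans ?_
  simp only [Pi.add_apply]
  rw [integral_add hKi hsum, integral_finsetSum _ (f := fun (j : Fin n) t =>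
    (slab A B A j).indicator (fun _ => (1 : ℝ)) t + (slab A B B j).indicator (fun _ => (1 : ℝ)) t)
    fun j _ => (hsi A j).add (hsi B j)]
  have hDv : (volume (Set.Icc A B)).toReal ≤ M ^ n := by
    rw [Real.volume_Icc_pi_toReal (fun k => by have := h0 k; linarith)]
    refine (Finset.prod_le_prod (fun k _ => h0 k) (fun k _ => hM' k)).trans ?_
    simp
  refine add_le_add ?_ ?_
  · rw [integral_indicator_const _ hDm, smul_eq_mul, mul_comm]
    exact mul_le_mul_of_nonneg_left hDv hK
  · calc _ ≤ ∑ j : Fin n, 2 * (2 * M) ^ (n - 1) := by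
          refine Finset.sum_le_sum fun j _ => ?_
          rw [integral_add (hsi A j) (hsi B j), integral_indicator_const _ (hsm A j),
            integral_indicator_const _ (hsm B j)]
          have a1 := slab_vol A B A j (2 * M) h0 hM
          have a2 := slab_vol A B B j (2 * M) h0 hM
          simp only [smul_eq_mul, mul_one, Measure.real]
          linarith
      _ = _ := by simp; ring

lemma change_var {n : ℕ} (a b z : Fin n → ℝ) (P q : ℝ) (hP : 0 < P) (hq : 0 < q)
    (g : (Fin n → ℝ) → ℂ) :
    ∫ t in Set.Icc (fun j => (P * a j - z j) / q) (fun j => (P * b j - z j) / q),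
      g (fun j => (z j + q * t j) / P) = ((q : ℂ) ^ n)⁻¹ * (P : ℂ) ^ n * ∫ ζ in boxSet a b, g ζ := by
  have hbox : boxSet a b = Set.Icc a b := by unfold boxSet; exact Set.pi_univ_Icc a b
  rw [hbox, ← integral_indicator measurableSet_Icc, ← integral_indicator measurableSet_Icc]
  have e : (Set.Icc (fun j => (P * a j - z j) / q) (fun j => (P * b j - z j) / q)).indicator
      (fun t => g (fun j => (z j + q * t j) / P)) =
      fun t => (fun s => (Set.Icc a b).indicator g ((fun j => z j / P) + s)) ((q / P) • t) := by
    funext t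
    classical
    have e1 : (fun j => z j / P) + (q / P) • t = fun j => (z j + q * t j) / P := by
      funext j; simp; ring
    simp only [e1]
    rw [Set.indicator_apply, Set.indicator_apply]
    refine if_congr ?_ rfl rfl
    simp only [Set.mem_Icc, Pi.le_def, div_le_iff₀ hq, le_div_iff₀ hq, div_le_iff₀ hP,
      le_div_iff₀ hP]
    refine and_congr (forall_congr' fun j => ?_) (forall_congr' fun j => ?_)
    · constructor <;> intro h <;> linarith
    · constructor <;> intro h <;> linarith
  rw [e, Measure.integral_comp_smul, integral_add_left_eq_self]
  rw [abs_of_pos (by positivity)]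
  simp only [Module.finrank_fintype_fun_eq_card, Fintype.card_fin, Complex.real_smul]
  congr 1
  push_cast
  rw [div_pow, inv_div]
  ring

/-- **Lemma 2.7 (replacing an exponential sum by an oscillatory integral).** -/
theorem sum_to_integral (n R d : ℕ) (hR : 0 < R) (hd : 2 ≤ d) (hnR : R < n) :
    ∃ c : ℝ, 0 < c ∧
      ∀ (f : Fin R → MvPolynomial (Fin n) ℤ),
        (∀ i, (f i).totalDegree = d) →
        ∀ C Ct : ℝ, 1 ≤ C → 1 ≤ Ct →
        coeffMax f C →
        coeffMax (fun i => MvPolynomial.homogeneousComponent d (f i)) Ct →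
        ∀ (aB bB : Fin n → ℝ),
        (∀ j, -1 ≤ aB j ∧ 0 < bB j - aB j ∧ bB j - aB j < 1 ∧ bB j ≤ 1) →
        ∀ P : ℝ, 1 ≤ P →
        ∀ (z : Fin n → ℤ) (β : Fin R → ℝ) (q : ℕ), 1 ≤ q → (q : ℝ) ≤ P →
          ‖(∑ y ∈ Finset.Icc (fun j => ⌈(P * aB j - (z j : ℝ)) / (q : ℝ)⌉)
                (fun j => ⌊(P * bB j - (z j : ℝ)) / (q : ℝ)⌋),
              eC (∑ i, β i * (MvPolynomial.eval (fun j => z j + (q : ℤ) * y j) (f i) : ℝ))) -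
            ((q : ℂ) ^ n)⁻¹ * (P : ℂ) ^ n *
              Iosc (fun i => MvPolynomial.homogeneousComponent d (f i)) (boxSet aB bB)
                (fun i => P ^ d * β i)‖ ≤
          c * (C * P ^ d * (⨆ i, |β i|) + 1) * (q : ℝ) ^ (1 - (n : ℝ)) * P ^ ((n : ℝ) - 1) := by
  set N : ℝ := ((Finset.Iic (Finsupp.equivFunOnFinite.symm (fun _ : Fin n => d))).card : ℝ) with hN
  have hN0 : 0 ≤ N := by positivity
  have hn1 : 1 ≤ n := by omega
  have hn0 : (0 : ℝ) < n := by exact_mod_cast hn1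
  refine ⟨2 * Real.pi * R * N * d + 2 * n * 2 ^ (n - 1), by positivity, ?_⟩
  intro f hf C Ct hC _ hCm _ aB bB hab P hP z β q hq hqP
  have hP0 : 0 < P := by linarith
  have hq1 : (1 : ℝ) ≤ q := by exact_mod_cast hq
  have hq0 : (0 : ℝ) < q := by linarith
  set b := ⨆ i, |β i| with hb
  have hbi : ∀ i, |β i| ≤ b := fun i => le_ciSup (f := fun i => |β i|) (Set.finite_range _).bddAbove i
  have hb0 : 0 ≤ b := (abs_nonneg _).trans (hbi ⟨0, hR⟩)
  have hCi : ∀ i m, |(((f i).coeff m : ℤ) : ℝ)| ≤ C := fun i m => hCm.2 ⟨i, m, rfl⟩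
  have hMq : 1 ≤ P / q := (one_le_div hq0).2 hqP
  set g : (Fin n → ℝ) → ℂ := fun ζ => eC (∑ i, P ^ d * β i *
    MvPolynomial.aeval ζ (MvPolynomial.homogeneousComponent d (f i))) with hg
  have hgc : Continuous g := by
    refine eC_continuous.comp (continuous_finsetSum _ fun i _ => continuous_const.mul ?_)
    simp only [MvPolynomial.aeval_def, MvPolynomial.eval₂_eq']
    fun_prop
  have hwid : ∀ k, (P * bB k - z k) / q - (P * aB k - z k) / q = (P / q) * (bB k - aB k) := by
    intro k; ring
  have hcmp := main_compare hn1 (fun j => (P * aB j - (z j : ℝ)) / (q : ℝ))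
    (fun j => (P * bB j - (z j : ℝ)) / (q : ℝ)) (P / q)
    (2 * Real.pi * (R * (b * (N * (C * d * q * P ^ d) / P)))) (by positivity)
    (fun k => by
      rw [hwid]; have := (hab k).2.1; positivity)
    (fun k => by
      rw [hwid]; have := (hab k).2.2.1; nlinarith)
    (fun k => by
      rw [hwid]; have := (hab k).2.2.1; nlinarith)
    (fun y => eC (∑ i, β i * (MvPolynomial.eval (fun j => z j + (q : ℤ) * y j) (f i) : ℝ)))
    (fun t => g (fun j => ((z j : ℝ) + q * t j) / P))
    (fun y => (eC_norm _).le) (fun t => (eC_norm _).le)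
    (hgc.comp (by fun_prop)) ?_
  · rw [change_var aB bB (fun j => (z j : ℝ)) P q hP0 hq0 g] at hcmp
    have hrp : (q : ℝ) ^ (1 - (n : ℝ)) * P ^ ((n : ℝ) - 1) = (P / q) ^ (n - 1) := by
      rw [show (1 - (n : ℝ)) = -((n - 1 : ℕ) : ℝ) by push_cast [Nat.cast_sub hn1]; ring,
        show (n : ℝ) - 1 = ((n - 1 : ℕ) : ℝ) by push_cast [Nat.cast_sub hn1]; ring,
        Real.rpow_neg hq0.le, Real.rpow_natCast, Real.rpow_natCast, div_pow]
      field_simp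
    rw [mul_assoc (_ * _) _ (P ^ ((n : ℝ) - 1)), hrp]
    unfold Iosc
    rw [Complex.ofReal_natCast] at hcmp
    refine hcmp.trans ?_
    have hMn : (P / q) ^ n = (P / q) * (P / q) ^ (n - 1) := by
      rw [← pow_succ', Nat.sub_add_cancel hn1]
    rw [hMn, mul_pow]
    have hX : 0 ≤ (P / q) ^ (n - 1) := by positivity
    have : 2 * Real.pi * (R * (b * (N * (C * d * q * P ^ d) / P))) * ((P / q) * (P / q) ^ (n - 1))
        = (2 * Real.pi * R * N * d) * (C * P ^ d * b) * (P / q) ^ (n - 1) := by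
      field_simp
    rw [this, show 2 * (n : ℝ) * (2 ^ (n - 1) * (P / q) ^ (n - 1)) =
      (2 * n * 2 ^ (n - 1)) * (P / q) ^ (n - 1) by ring, ← add_mul]
    refine mul_le_mul_of_nonneg_right ?_ hX
    have h1 : 0 ≤ 2 * Real.pi * R * N * d := by positivity
    have h2 : 0 ≤ 2 * (n : ℝ) * 2 ^ (n - 1) := by positivity
    have h3 : 0 ≤ C * P ^ d * b := by positivity
    nlinarith [mul_nonneg h2 h3]
  · intro t ht hfl
    refine (eC_lip _ _).trans ?_
    refine mul_le_mul_of_nonneg_left ?_ (by positivity)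
    rw [← Finset.sum_sub_distrib]
    refine (Finset.abs_sum_le_sum_abs _ _).trans ?_
    calc _ ≤ ∑ i : Fin R, b * (N * (C * d * q * P ^ d) / P) := by
          refine Finset.sum_le_sum fun i _ => ?_
          rw [show ∀ u v : ℝ, β i * u - P ^ d * β i * v = β i * (u - P ^ d * v) by intros; ring,
            abs_mul]
          refine mul_le_mul (hbi i) ?_ (abs_nonneg _) hb0
          rw [le_div_iff₀ hP0, mul_comm]
          have hr : ∀ j, |(z j : ℝ) + q * t j| ≤ P := by
            intro j
            obtain ⟨h1, h2⟩ := ht j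
            rw [div_le_iff₀ hq0] at h1
            rw [le_div_iff₀ hq0] at h2
            obtain ⟨h3, -, -, h4⟩ := hab j
            rw [abs_le]; constructor <;> nlinarith
          have hc : ∀ j, P * (((z j : ℝ) + q * t j) / P) = (z j : ℝ) + q * t j := fun j => by
            field_simp
          refine poly_bound (by omega) (f i) (hf i) C (hCi i) hP hq1 _ _ ?_ ?_ ?_
          · intro j
            have h1 := hfl j
            obtain ⟨-, h2⟩ := ht j
            have h5 := Int.floor_le (t j)
            rw [div_le_iff₀ hq0] at h1
            rw [le_div_iff₀ hq0] at h2
            obtain ⟨h3, -, -, h4⟩ := hab j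
            push_cast
            rw [abs_le]; constructor <;> nlinarith
          · intro j
            rw [hc]; exact hr j
          · intro j
            rw [hc]
            push_cast
            have h5 := Int.floor_le (t j)
            have h6 := Int.lt_floor_add_one (t j)
            rw [abs_le]; constructor <;> nlinarith
      _ = _ := by simp

end
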